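/- arXiv:2411.15485 — 2 statements merged into one kernel-verified Lean document; each statement's English description precedes it below -/
import Mathlib

section
/- There exists a constant β₀ ≥ 0 such that for every β ≥ β₀ there exist n₀ ≥ 1 and T₀ > 0 satisfying sup_{n ≥ n₀} ∫_{T₀}^∞ t·e^{−(β/n)t}·γ_n·Π̄_n(t) dt ≤ c/8 and inf_{n ≥ n₀} ∫₀^{T₀} t·e^{−(β/n)t}·γ_n·Π̄_n(t) dt ≥ 3c/4. -/
open MeasureTheory Real Set Filter Topology

noncomputable def tailNu (ν : Measure ℝ) (y : ℝ) : ℝ := (ν (Set.Ici y)).toReal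

noncomputable def itailNu (ν : Measure ℝ) (x : ℝ) : ℝ := ∫ y in Set.Ioi x, tailNu ν y

noncomputable def phi (b c : ℝ) (ν : Measure ℝ) (l : ℝ) : ℝ :=
  b * l + c * l ^ 2 + ∫ y in Set.Ioi (0 : ℝ), (Real.exp (-l * y) - 1 + l * y) ∂ν

noncomputable def expDens (c y : ℝ) : ℝ := (1 / c) * Real.exp (-y / c)

noncomputable def gam (b c : ℝ) (ν : Measure ℝ) (η : ℕ → ℝ) (n : ℕ) : ℝ :=
  (1 / c) * max 0 (1 - b / (n : ℝ) - (1 / (n : ℝ)) * ∫ y in Set.Ioi (0 : ℝ), tailNu ν (η n + y))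

noncomputable def piDens (c θn : ℝ) (Λn : Measure ℝ) (y : ℝ) : ℝ :=
  (1 - θn) * expDens c y + θn * ∫ u in Set.Icc (0 : ℝ) y, expDens c (y - u) ∂Λn

noncomputable def piTail (c θn : ℝ) (Λn : Measure ℝ) (x : ℝ) : ℝ :=
  ∫ y in Set.Ioi x, piDens c θn Λn y

noncomputable def piTailL1 (c θn : ℝ) (Λn : Measure ℝ) : ℝ :=
  ∫ y in Set.Ioi (0 : ℝ), piTail c θn Λn y


theorem expDens_nonneg {c : ℝ} (hc : 0 < c) (y : ℝ) : 0 ≤ expDens c y := by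
  unfold expDens; positivity

theorem expDens_cont (c : ℝ) : Continuous (expDens c) := by
  unfold expDens; fun_prop

theorem expDens_intOn {c : ℝ} (hc : 0 < c) (a : ℝ) : IntegrableOn (expDens c) (Ioi a) := by
  have h := (integrableOn_exp_mul_Ioi (a := -(1/c)) (by simpa using hc) a).const_mul (1/c)
  refine h.congr (ae_of_all _ fun y => ?_)
  simp only [expDens]
  congr 2; ring

theorem expDens_int {c : ℝ} (hc : 0 < c) (a : ℝ) :
    ∫ y in Ioi a, expDens c y = rexp (-a / c) := by
  have h := integral_exp_mul_Ioi (a := -(1/c)) (by simpa using hc) a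
  have h2 : ∫ y in Ioi a, expDens c y = ∫ y in Ioi a, (1/c) * rexp (-(1/c) * y) := by
    congr 1; ext y; simp only [expDens]; congr 2; ring
  rw [h2, integral_const_mul, h]
  have : -(1/c) * a = -a / c := by ring
  rw [this]; field_simp

theorem expDens_lint {c : ℝ} (hc : 0 < c) (a : ℝ) :
    ∫⁻ y in Ioi a, ENNReal.ofReal (expDens c y) = ENNReal.ofReal (rexp (-a / c)) := by
  rw [← expDens_int hc, ofReal_integral_eq_lintegral_ofReal (expDens_intOn hc a)
    (ae_of_all _ (expDens_nonneg hc))]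

noncomputable def gG (c : ℝ) (L : Measure ℝ) (y : ℝ) : ℝ :=
  ∫ u in Set.Icc (0 : ℝ) y, expDens c (y - u) ∂L

theorem gG_nonneg {c : ℝ} (hc : 0 < c) (L : Measure ℝ) (y : ℝ) : 0 ≤ gG c L y :=
  integral_nonneg fun _ => expDens_nonneg hc _

theorem gG_meas (c : ℝ) (L : Measure ℝ) [IsProbabilityMeasure L] :
    StronglyMeasurable (gG c L) := by
  have hm : Measurable (Function.uncurry fun y u : ℝ =>
      (Icc (0:ℝ) y).indicator (fun u => expDens c (y - u)) u) := by
    have hs : MeasurableSet {p : ℝ × ℝ | 0 ≤ p.2 ∧ p.2 ≤ p.1} :=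
      (measurableSet_le measurable_const measurable_snd).inter
        (measurableSet_le measurable_snd measurable_fst)
    have : Measurable (fun p : ℝ × ℝ => expDens c (p.1 - p.2)) :=
      (expDens_cont c).measurable.comp (measurable_fst.sub measurable_snd)
    convert this.indicator hs using 1
    ext ⟨y, u⟩
    simp [Function.uncurry, indicator, mem_Icc]
  have := (hm.stronglyMeasurable).integral_prod_right (ν := L)
  convert this using 1
  ext y
  rw [integral_indicator measurableSet_Icc]
  rfl

theorem gG_lint {c : ℝ} (hc : 0 < c) (L : Measure ℝ) [IsProbabilityMeasure L] {x : ℝ}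
    (hx : 0 ≤ x) :
    ∫⁻ y in Ioi x, ‖gG c L y‖ₑ ≤ ENNReal.ofReal (rexp (-(x/2) / c)) + L (Ici (x/2)) := by
  set H : ℝ → ENNReal := (Ici (0:ℝ)).indicator (fun z => ENNReal.ofReal (expDens c z)) with hH
  have hHm : Measurable H :=
    ((expDens_cont c).measurable.ennreal_ofReal).indicator measurableSet_Ici
  have h1 : ∀ y, ‖gG c L y‖ₑ ≤ ∫⁻ u, H (y - u) ∂L := by
    intro y
    refine (enorm_integral_le_lintegral_enorm _).trans ?_
    rw [← lintegral_indicator measurableSet_Icc]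
    refine lintegral_mono fun u => ?_
    by_cases hu : u ∈ Icc (0:ℝ) y
    · rw [indicator_of_mem hu, hH, indicator_of_mem (by simpa using hu.2),
        Real.enorm_eq_ofReal (expDens_nonneg hc _)]
    · rw [indicator_of_notMem hu]; exact bot_le
  have h2 : ∀ u, ∫⁻ y in Ioi x, H (y - u) ≤
      ENNReal.ofReal (rexp (-(x/2) / c)) + (Ici (x/2)).indicator 1 u := by
    intro u
    by_cases hu : x / 2 ≤ u
    · rw [indicator_of_mem (by exact hu)]
      refine le_trans ?_ le_add_self
      refine (setLIntegral_le_lintegral _ _).trans ?_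
      rw [lintegral_sub_right_eq_self H u, hH, lintegral_indicator measurableSet_Ici,
        setLIntegral_congr Ioi_ae_eq_Ici.symm, expDens_lint hc]
      simp
    · refine le_trans ?_ le_self_add
      rw [← expDens_lint hc, ← lintegral_indicator measurableSet_Ioi,
        ← lintegral_indicator measurableSet_Ioi,
        ← lintegral_sub_right_eq_self (fun z => (Ioi (x/2)).indicator _ z) u]
      refine lintegral_mono fun y => ?_
      by_cases hy : y ∈ Ioi x
      · have hy' : x < y := hy
        rw [indicator_of_mem hy, hH, indicator_of_mem (by simp; linarith),
          indicator_of_mem (by simp; linarith)]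
      · rw [indicator_of_notMem hy]; exact bot_le
  calc ∫⁻ y in Ioi x, ‖gG c L y‖ₑ ≤ ∫⁻ y in Ioi x, ∫⁻ u, H (y - u) ∂L := lintegral_mono h1
    _ = ∫⁻ u, (∫⁻ y in Ioi x, H (y - u)) ∂L := by
        apply lintegral_lintegral_swap
        exact (hHm.comp (measurable_fst.sub measurable_snd)).aemeasurable
    _ ≤ ∫⁻ u, (ENNReal.ofReal (rexp (-(x/2) / c)) + (Ici (x/2)).indicator 1 u) ∂L :=
        lintegral_mono h2
    _ = _ := by
        rw [lintegral_add_left measurable_const, lintegral_indicator_one measurableSet_Ici]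
        simp

theorem gG_intOn {c : ℝ} (hc : 0 < c) (L : Measure ℝ) [IsProbabilityMeasure L] {x : ℝ}
    (hx : 0 ≤ x) : IntegrableOn (gG c L) (Ioi x) := by
  refine ⟨(gG_meas c L).aestronglyMeasurable, (gG_lint hc L hx).trans_lt ?_⟩
  exact ENNReal.add_lt_top.2 ⟨ENNReal.ofReal_lt_top, measure_lt_top _ _⟩

theorem gG_int_le {c : ℝ} (hc : 0 < c) (L : Measure ℝ) [IsProbabilityMeasure L] {x : ℝ}
    (hx : 0 ≤ x) : ∫ y in Ioi x, gG c L y ≤ rexp (-(x/2) / c) + (L (Ici (x/2))).toReal := by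
  rw [integral_eq_lintegral_of_nonneg_ae (ae_of_all _ (gG_nonneg hc L))
    (gG_meas c L).aestronglyMeasurable]
  have h := gG_lint hc L hx
  have h3 := ENNReal.toReal_mono (ENNReal.add_lt_top.2
    ⟨ENNReal.ofReal_lt_top, measure_lt_top _ _⟩).ne h
  rw [ENNReal.toReal_add ENNReal.ofReal_ne_top (measure_lt_top _ _).ne,
    ENNReal.toReal_ofReal (exp_pos _).le] at h3
  refine le_trans (le_of_eq ?_) h3
  congr 1
  refine lintegral_congr fun y => ?_
  rw [Real.enorm_eq_ofReal (gG_nonneg hc L y)]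

theorem piDens_nonneg {c θ : ℝ} (hc : 0 < c) (h0 : 0 ≤ θ) (h1 : θ < 1) (L : Measure ℝ) (y : ℝ) :
    0 ≤ piDens c θ L y :=
  add_nonneg (mul_nonneg (by linarith) (expDens_nonneg hc y)) (mul_nonneg h0 (gG_nonneg hc L y))

theorem piDens_intOn {c θ : ℝ} (hc : 0 < c) (L : Measure ℝ) [IsProbabilityMeasure L] {x : ℝ}
    (hx : 0 ≤ x) : IntegrableOn (piDens c θ L) (Ioi x) :=
  ((expDens_intOn hc x).const_mul (1 - θ)).add ((gG_intOn hc L hx).const_mul θ)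

theorem piTail_eq {c θ : ℝ} (hc : 0 < c) (L : Measure ℝ) [IsProbabilityMeasure L] {x : ℝ}
    (hx : 0 ≤ x) : piTail c θ L x = (1 - θ) * rexp (-x / c) + θ * ∫ y in Ioi x, gG c L y := by
  have : piTail c θ L x = ∫ y in Ioi x, ((1 - θ) * expDens c y + θ * gG c L y) := rfl
  rw [this, integral_add ((expDens_intOn hc x).const_mul (1 - θ))
    ((gG_intOn hc L hx).const_mul θ), integral_const_mul, integral_const_mul, expDens_int hc]

theorem piTail_anti {c θ : ℝ} (hc : 0 < c) (h0 : 0 ≤ θ) (h1 : θ < 1) (L : Measure ℝ)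
    [IsProbabilityMeasure L] : AntitoneOn (piTail c θ L) (Ici 0) := by
  intro x hx y hy hxy
  exact setIntegral_mono_set (piDens_intOn hc L hx) (ae_of_all _ (piDens_nonneg hc h0 h1 L))
    (Ioi_subset_Ioi hxy).eventuallyLE

theorem piTail_nonneg {c θ : ℝ} (hc : 0 < c) (h0 : 0 ≤ θ) (h1 : θ < 1) (L : Measure ℝ) (x : ℝ) :
    0 ≤ piTail c θ L x := integral_nonneg (piDens_nonneg hc h0 h1 L)

theorem piTail_ge {c θ : ℝ} (hc : 0 < c) (h0 : 0 ≤ θ) (L : Measure ℝ)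
    [IsProbabilityMeasure L] {x : ℝ} (hx : 0 ≤ x) :
    (1 - θ) * rexp (-x / c) ≤ piTail c θ L x := by
  rw [piTail_eq hc L hx]
  have := mul_nonneg h0 (integral_nonneg (μ := volume.restrict (Ioi x)) (gG_nonneg hc L))
  linarith

theorem piTail_le {c θ : ℝ} (hc : 0 < c) (h0 : 0 ≤ θ) (h1 : θ < 1) (L : Measure ℝ)
    [IsProbabilityMeasure L] {x : ℝ} (hx : 0 ≤ x) :
    piTail c θ L x ≤ rexp (-(1/(2*c)) * x) + θ * (L (Ici (x/2))).toReal := by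
  rw [piTail_eq hc L hx]
  have h2 := mul_le_mul_of_nonneg_left (gG_int_le hc L hx) h0
  have h3 : -(x/2)/c = -(1/(2*c)) * x := by field_simp
  have h4 : rexp (-x/c) ≤ rexp (-(1/(2*c)) * x) := by
    rw [← h3]; apply exp_le_exp.2; gcongr; linarith
  rw [h3] at h2
  have h5 := mul_le_mul_of_nonneg_left h4 (by linarith : 0 ≤ 1 - θ)
  linarith

theorem tail_fin (ν : Measure ℝ)
    (hνint : ∫⁻ y in Set.Ioi (0 : ℝ), ENNReal.ofReal (min y (y ^ 2)) ∂ν ≠ ⊤) {s : ℝ} (hs : 0 < s) :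
    ν (Ici s) ≠ ⊤ := by
  intro htop
  apply hνint
  have hm : Measurable fun y : ℝ => ENNReal.ofReal (min y (y ^ 2)) := by fun_prop
  have hp : 0 < min s (s^2) := by positivity
  have h := mul_meas_ge_le_lintegral (μ := ν.restrict (Ioi 0)) hm (ENNReal.ofReal (min s (s^2)))
  have h2 : (⊤ : ENNReal) ≤ (ν.restrict (Ioi 0))
      {x | ENNReal.ofReal (min s (s^2)) ≤ ENNReal.ofReal (min x (x^2))} := by
    rw [← htop, ← Measure.restrict_eq_self ν (t := Ioi 0) (s := Ici s)
      (fun y hy => lt_of_lt_of_le hs hy)]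
    refine measure_mono fun y hy => ?_
    have hy' : s ≤ y := hy
    apply ENNReal.ofReal_le_ofReal
    gcongr
  rw [top_le_iff.1 h2, ENNReal.mul_top (by simpa using ⟨hs, hs.ne'⟩)] at h
  exact top_le_iff.1 h

theorem tailNu_nonneg (ν : Measure ℝ) (s : ℝ) : 0 ≤ tailNu ν s := ENNReal.toReal_nonneg

theorem tailNu_mono {ν : Measure ℝ} {s t : ℝ} (h : ν (Ici s) ≠ ⊤) (hst : s ≤ t) :
    tailNu ν t ≤ tailNu ν s :=
  ENNReal.toReal_mono h (measure_mono (Ici_subset_Ici.2 hst))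

theorem tailNu_aem (ν : Measure ℝ)
    (hνint : ∫⁻ y in Set.Ioi (0 : ℝ), ENNReal.ofReal (min y (y ^ 2)) ∂ν ≠ ⊤) :
    AEMeasurable (tailNu ν) (volume.restrict (Ioi 0)) :=
  aemeasurable_restrict_of_antitoneOn measurableSet_Ioi
    (fun _ hx _ _ hxy => tailNu_mono (tail_fin ν hνint hx) hxy)

theorem tail_int (ν : Measure ℝ) (hν0 : ν (Set.Iic 0) = 0)
    (hνint : ∫⁻ y in Set.Ioi (0 : ℝ), ENNReal.ofReal (min y (y ^ 2)) ∂ν ≠ ⊤) :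
    IntegrableOn (fun s => tailNu ν s * min s 1) (Ioi 0) := by
  have hae : ∀ᵐ y ∂ν, 0 < y := by
    rw [ae_iff]; convert hν0 using 2; ext; simp
  have hcont : Continuous fun s : ℝ => min s 1 := by fun_prop
  have key := lintegral_comp_eq_lintegral_meas_le_mul (f := fun y : ℝ => y)
    (g := fun s : ℝ => min s 1) ν (hae.mono fun y hy => hy.le) aemeasurable_id
    (fun t _ => hcont.intervalIntegrable _ _)
    ((ae_restrict_iff' measurableSet_Ioi).2 (ae_of_all _ fun t (ht : 0 < t) => by positivity))
  have hfin : ∫⁻ t in Ioi 0, ν {a : ℝ | t ≤ a} * ENNReal.ofReal (min t 1) < ⊤ := by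
    rw [← key]
    refine lt_of_le_of_lt ?_ (lt_top_iff_ne_top.2 hνint)
    have : ν.restrict (Ioi 0) = ν := Measure.restrict_eq_self_of_ae_mem hae
    rw [this]
    refine lintegral_mono_ae (hae.mono fun y hy => ENNReal.ofReal_le_ofReal ?_)
    apply le_min
    · calc ∫ t in (0:ℝ)..y, min t 1 ≤ ∫ t in (0:ℝ)..y, (1:ℝ) :=
            intervalIntegral.integral_mono_on hy.le (hcont.intervalIntegrable _ _)
              (by simp) (fun x _ => min_le_right _ _)
        _ = y := by simp
    · calc ∫ t in (0:ℝ)..y, min t 1 ≤ ∫ t in (0:ℝ)..y, y :=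
            intervalIntegral.integral_mono_on hy.le (hcont.intervalIntegrable _ _)
              (by simp) (fun x hx => (min_le_left _ _).trans hx.2)
        _ = y^2 := by simp; ring
  refine ⟨((tailNu_aem ν hνint).mul hcont.aemeasurable).aestronglyMeasurable, ?_⟩
  refine lt_of_le_of_lt (le_of_eq ?_) hfin
  refine setLIntegral_congr_fun measurableSet_Ioi fun t (ht : 0 < t) => ?_
  have hn : 0 ≤ min t 1 := by positivity
  change ‖tailNu ν t * min t 1‖ₑ = ν (Ici t) * _
  rw [enorm_mul, Real.enorm_eq_ofReal hn, Real.enorm_eq_ofReal (tailNu_nonneg ν t), tailNu,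
    ENNReal.ofReal_toReal (tail_fin ν hνint ht)]

theorem sexp_le {β s : ℝ} (hβ : 1 ≤ β) (hs : 0 < s) : s * rexp (-(2*β) * s) ≤ min s 1 := by
  apply le_min
  · have : rexp (-(2*β)*s) ≤ 1 := by
      apply exp_le_one_iff.2; nlinarith
    nlinarith
  · have h1 : rexp (-(2*β)*s) ≤ rexp (-s) := by apply exp_le_exp.2; nlinarith
    have h2 : s + 1 ≤ rexp s := add_one_le_exp s
    have h3 : rexp s * rexp (-s) = 1 := by rw [← exp_add]; simp
    nlinarith [exp_pos (-s)]

theorem F_bound (ν : Measure ℝ) {β s : ℝ} (hβ : 1 ≤ β) (hs : 0 < s) :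
    ‖s * rexp (-(2*β) * s) * tailNu ν s‖ ≤ tailNu ν s * min s 1 := by
  rw [Real.norm_of_nonneg (mul_nonneg (by positivity) (tailNu_nonneg ν s)), mul_comm]
  exact mul_le_mul_of_nonneg_left (sexp_le hβ hs) (tailNu_nonneg ν s)

theorem F_aem (ν : Measure ℝ)
    (hνint : ∫⁻ y in Set.Ioi (0 : ℝ), ENNReal.ofReal (min y (y ^ 2)) ∂ν ≠ ⊤) (β : ℝ) :
    AEStronglyMeasurable (fun s => s * rexp (-(2*β) * s) * tailNu ν s) (volume.restrict (Ioi 0)) :=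
  by
  have : Continuous fun s : ℝ => s * rexp (-(2*β) * s) := by fun_prop
  exact (this.aemeasurable.mul (tailNu_aem ν hνint)).aestronglyMeasurable

theorem F_int (ν : Measure ℝ) (hν0 : ν (Set.Iic 0) = 0)
    (hνint : ∫⁻ y in Set.Ioi (0 : ℝ), ENNReal.ofReal (min y (y ^ 2)) ∂ν ≠ ⊤) {β : ℝ}
    (hβ : 1 ≤ β) : IntegrableOn (fun s => s * rexp (-(2*β) * s) * tailNu ν s) (Ioi 0) :=
  (tail_int ν hν0 hνint).mono' (F_aem ν hνint β)
    ((ae_restrict_iff' measurableSet_Ioi).2 (ae_of_all _ fun _ hs => F_bound ν hβ hs))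

theorem F_lim (ν : Measure ℝ) (hν0 : ν (Set.Iic 0) = 0)
    (hνint : ∫⁻ y in Set.Ioi (0 : ℝ), ENNReal.ofReal (min y (y ^ 2)) ∂ν ≠ ⊤) :
    Tendsto (fun β : ℝ => ∫ s in Ioi 0, s * rexp (-(2*β) * s) * tailNu ν s) atTop (𝓝 0) := by
  have := tendsto_integral_filter_of_dominated_convergence (μ := volume.restrict (Ioi 0))
    (l := atTop) (F := fun β s : ℝ => s * rexp (-(2*β) * s) * tailNu ν s) (f := fun _ => 0)
    (fun s => tailNu ν s * min s 1)
    (Eventually.of_forall fun β => F_aem ν hνint β)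
    ((eventually_ge_atTop 1).mono fun β hβ =>
      (ae_restrict_iff' measurableSet_Ioi).2 (ae_of_all _ fun _ hs => F_bound ν hβ hs))
    (tail_int ν hν0 hνint)
    ((ae_restrict_iff' measurableSet_Ioi).2 (ae_of_all _ fun s (hs : 0 < s) => by
      have h1 : Tendsto (fun β : ℝ => -(2*β)*s) atTop atBot := by
        have : Tendsto (fun β : ℝ => β * (2*s)) atTop atTop :=
          tendsto_id.atTop_mul_const (by positivity)
        refine (tendsto_neg_atTop_atBot.comp this).congr fun β => ?_
        simp only [Function.comp]; ring
      have h2 := ((tendsto_exp_atBot.comp h1).const_mul s).mul_const (tailNu ν s)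
      simpa using h2))
  simpa using this

theorem D_le (ν : Measure ℝ) (hν0 : ν (Set.Iic 0) = 0)
    (hνint : ∫⁻ y in Set.Ioi (0 : ℝ), ENNReal.ofReal (min y (y ^ 2)) ∂ν ≠ ⊤) {η : ℝ} (hη : 0 ≤ η)
    (hf : ν (Ici η) ≠ ⊤) :
    ∫ y in Ioi (0:ℝ), tailNu ν (η + y) ≤
      tailNu ν η + ∫ s in Ioi (0:ℝ), tailNu ν s * min s 1 := by
  have hi := tail_int ν hν0 hνint
  have hI : IntegrableOn (fun _ : ℝ => tailNu ν η) (Ioc 0 1) := by simp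
  have hI' : Integrable ((Ioc (0:ℝ) 1).indicator fun _ : ℝ => tailNu ν η)
      (volume.restrict (Ioi 0)) := (hI.integrable_indicator measurableSet_Ioc).integrableOn
  have : tailNu ν η = ∫ y in Ioi (0:ℝ), (Ioc (0:ℝ) 1).indicator (fun _ : ℝ => tailNu ν η) y := by
    rw [setIntegral_indicator measurableSet_Ioc]
    have : Ioi (0:ℝ) ∩ Ioc 0 1 = Ioc 0 1 := by ext; simp
    rw [this]; simp
  rw [this, ← integral_add hI' hi]
  refine integral_mono_of_nonneg (ae_of_all _ fun _ => tailNu_nonneg _ _) (hI'.add hi) ?_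
  refine (ae_restrict_iff' measurableSet_Ioi).2 (ae_of_all _ fun y (hy : 0 < y) => ?_)
  have hn : 0 ≤ tailNu ν y * min y 1 := mul_nonneg (tailNu_nonneg _ _) (by positivity)
  by_cases h1 : y ≤ 1
  · simp only [indicator_of_mem (show y ∈ Ioc (0:ℝ) 1 from ⟨hy, h1⟩)]
    have := tailNu_mono hf (show η ≤ η + y by linarith)
    linarith
  · simp only [indicator_of_notMem (show y ∉ Ioc (0:ℝ) 1 from fun h => h1 h.2)]
    rw [min_eq_right (le_of_not_ge h1)]
    have := tailNu_mono (tail_fin ν hνint hy) (show y ≤ η + y by linarith)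
    linarith

theorem te_intOn {r : ℝ} (hr : 0 < r) : IntegrableOn (fun t => t * rexp (-r * t)) (Ioi 0) := by
  have := integrableOn_rpow_mul_exp_neg_mul_rpow (p := 1) (s := 1) (b := r) (by norm_num)
    (by norm_num) hr
  simpa using this

theorem te_int {r : ℝ} (hr : 0 < r) : ∫ t in Ioi (0:ℝ), t * rexp (-r * t) = 1 / r ^ 2 := by
  have := integral_rpow_mul_exp_neg_mul_Ioi (a := 2) (r := r) (by norm_num) hr
  have e : (2:ℝ) - 1 = 1 := by norm_num
  rw [e] at this
  simp only [rpow_one, Gamma_two, mul_one] at this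
  simp only [neg_mul]
  rw [this]
  norm_num

theorem te_lim {r : ℝ} (hr : 0 < r) :
    Tendsto (fun T : ℝ => ∫ t in (0:ℝ)..T, t * rexp (-r * t)) atTop (𝓝 (1 / r ^ 2)) := by
  rw [← te_int hr]
  exact intervalIntegral_tendsto_integral_Ioi 0 (te_intOn hr) tendsto_id

theorem te_tail {r : ℝ} (hr : 0 < r) :
    Tendsto (fun T : ℝ => ∫ t in Ioi T, t * rexp (-r * t)) atTop (𝓝 0) := by
  have h := (te_lim hr).const_sub (1 / r ^ 2)
  rw [sub_self] at h
  refine h.congr' ((eventually_ge_atTop 0).mono fun T hT => ?_)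
  rw [← te_int hr, intervalIntegral.integral_of_le hT, ← Ioc_union_Ioi_eq_Ioi hT,
    setIntegral_union (Ioc_disjoint_Ioi le_rfl) measurableSet_Ioi
    ((te_intOn hr).mono_set Ioc_subset_Ioi_self) ((te_intOn hr).mono_set (Ioi_subset_Ioi hT))]
  ring

theorem gam_nonneg {b c : ℝ} (hc : 0 < c) (ν : Measure ℝ) (η : ℕ → ℝ) (n : ℕ) :
    0 ≤ gam b c ν η n := mul_nonneg (by positivity) (le_max_left _ _)

theorem gam_le {b c : ℝ} (hb : 0 ≤ b) (hc : 0 < c) (ν : Measure ℝ) (η : ℕ → ℝ) (n : ℕ) :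
    gam b c ν η n ≤ 1 / c := by
  have h1 : 0 ≤ b / (n:ℝ) := by positivity
  have h2 : 0 ≤ (1 / (n : ℝ)) * ∫ y in Set.Ioi (0 : ℝ), tailNu ν (η n + y) :=
    mul_nonneg (by positivity) (integral_nonneg fun _ => tailNu_nonneg _ _)
  have h3 : max 0 (1 - b / (n : ℝ) - (1 / (n : ℝ)) * ∫ y in Set.Ioi (0 : ℝ), tailNu ν (η n + y))
      ≤ 1 := max_le zero_le_one (by linarith)
  unfold gam
  calc _ ≤ (1/c) * 1 := mul_le_mul_of_nonneg_left h3 (by positivity)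
    _ = 1/c := mul_one _

/-- the rescaled integral -/
theorem J_scale (ν : Measure ℝ) {β : ℝ} {n : ℕ} (hn : 1 ≤ n)
    (hi : IntegrableOn (fun s => s * rexp (-(2*β) * s) * tailNu ν s) (Ioi 0)) :
    IntegrableOn (fun t => t * rexp (-(β / (n:ℝ)) * t) * ((1/(n:ℝ)^2) * tailNu ν (t / (2 * n))))
      (Ioi 0) ∧
    ∫ t in Ioi (0:ℝ), t * rexp (-(β / (n:ℝ)) * t) * ((1/(n:ℝ)^2) * tailNu ν (t / (2 * n))) =
      4 * ∫ s in Ioi (0:ℝ), s * rexp (-(2*β) * s) * tailNu ν s := by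
  have hn' : (0:ℝ) < n := by exact_mod_cast hn
  set F : ℝ → ℝ := fun s => s * rexp (-(2*β) * s) * tailNu ν s with hF
  have ha : 0 < 1 / (2 * (n:ℝ)) := by positivity
  have e : (fun t : ℝ => t * rexp (-(β / (n:ℝ)) * t) * ((1/(n:ℝ)^2) * tailNu ν (t / (2 * n)))) =
      fun t => (2 / (n:ℝ)) * F (1 / (2 * (n:ℝ)) * t) := by
    ext t
    have e1 : 1 / (2 * (n:ℝ)) * t = t / (2 * n) := by ring
    have e2 : -(2*β) * (t / (2 * (n:ℝ))) = -(β / (n:ℝ)) * t := by field_simp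
    simp only [hF]
    rw [e1, e2]
    field_simp
  rw [e]
  constructor
  · refine Integrable.const_mul ?_ _
    refine (integrableOn_Ioi_comp_mul_left_iff F 0 ha).2 ?_
    simpa using hi
  · rw [integral_const_mul, integral_comp_mul_left_Ioi F 0 ha]
    simp only [mul_zero, smul_eq_mul]
    field_simp
    ring

/-- Proposition 4.7: mass estimates for `t·e^{−(β/n)t}·γ_n·Π̄_n(t)`. -/
theorem stmt11
    (b c : ℝ) (hb : 0 ≤ b) (hc : 0 < c)
    (ν : Measure ℝ) (hν0 : ν (Set.Iic 0) = 0)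
    (hνint : ∫⁻ y in Set.Ioi (0 : ℝ), ENNReal.ofReal (min y (y ^ 2)) ∂ν ≠ ⊤)
    (η θ : ℕ → ℝ) (hη : ∀ n : ℕ, 0 ≤ η n) (hθ : ∀ n : ℕ, 0 ≤ θ n ∧ θ n < 1)
    (hseq : (ν (Set.Ici (0 : ℝ)) ≠ ⊤ ∧ (∀ n : ℕ, 1 ≤ n → η n = 0) ∧
        (∀ n : ℕ, 1 ≤ n → θ n = c * tailNu ν 0 / (n : ℝ) ^ 2)) ∨
      (ν (Set.Ici (0 : ℝ)) = ⊤ ∧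
        Filter.Tendsto (fun n : ℕ => (n : ℝ) * θ n) Filter.atTop (nhds 0) ∧
        Filter.Tendsto (fun n : ℕ => (n : ℝ) ^ 2 * θ n) Filter.atTop Filter.atTop ∧
        (∀ n : ℕ, 1 ≤ n → tailNu ν (η n) = (n : ℝ) ^ 2 * θ n / c)))
    (Λ : ℕ → Measure ℝ)
    (hΛprob : ∀ n : ℕ, 1 ≤ n → IsProbabilityMeasure (Λ n))
    (hΛsupp : ∀ n : ℕ, 1 ≤ n → Λ n (Set.Iic 0) = 0)
    (hΛtail : ∀ n : ℕ, 1 ≤ n → ∀ y : ℝ, 0 ≤ y →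
      ((Λ n) (Set.Ici y)).toReal = tailNu ν (η n + y / (n : ℝ)) / tailNu ν (η n))
    :
    ∃ β₀ : ℝ, 0 ≤ β₀ ∧ ∀ β : ℝ, β₀ ≤ β → ∃ n₀ : ℕ, 1 ≤ n₀ ∧ ∃ T₀ : ℝ, 0 < T₀ ∧
      (∀ n : ℕ, n₀ ≤ n →
        (∫ t in Set.Ioi T₀,
          t * Real.exp (-(β / (n : ℝ)) * t) * (gam b c ν η n * piTail c (θ n) (Λ n) t))
            ≤ c / 8) ∧
      (∀ n : ℕ, n₀ ≤ n →
        3 * c / 4 ≤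
          ∫ t in (0 : ℝ)..T₀,
            t * Real.exp (-(β / (n : ℝ)) * t) * (gam b c ν η n * piTail c (θ n) (Λ n) t)) := by
  have hA : ∀ n : ℕ, 1 ≤ n → tailNu ν (η n) = (n : ℝ) ^ 2 * θ n / c := by
    rcases hseq with ⟨-, h1, h2⟩ | ⟨-, -, -, h⟩
    · intro n hn
      have hn' : (0:ℝ) < n := by exact_mod_cast hn
      rw [h1 n hn, h2 n hn]; field_simp
    · exact h
  have hB : Tendsto (fun n : ℕ => (n : ℝ) * θ n) atTop (𝓝 0) := by
    rcases hseq with ⟨-, h1, h2⟩ | ⟨-, h, -, -⟩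
    · have : Tendsto (fun n : ℕ => c * tailNu ν 0 / (n:ℝ)) atTop (𝓝 0) :=
        tendsto_const_div_atTop_nhds_zero_nat _
      refine this.congr' ((eventually_ge_atTop 1).mono fun n hn => ?_)
      have hn' : (0:ℝ) < n := by exact_mod_cast hn
      dsimp only
      rw [h2 n hn]; field_simp
    · exact h
  have hB' : Tendsto θ atTop (𝓝 0) := by
    refine tendsto_of_tendsto_of_tendsto_of_le_of_le' tendsto_const_nhds hB
      (Eventually.of_forall fun n => (hθ n).1) ((eventually_ge_atTop 1).mono fun n hn => ?_)
    have hn' : (1:ℝ) ≤ n := by exact_mod_cast hn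
    nlinarith [(hθ n).1]
  have hpos : ∀ n : ℕ, 1 ≤ n → tailNu ν (η n) ≠ 0 := by
    intro n hn h0
    have hp := hΛprob n hn
    have := hΛtail n hn 0 le_rfl
    rw [h0, div_zero] at this
    have h1 : Λ n univ ≤ Λ n (Iic 0) + Λ n (Ici 0) := by
      rw [← Iic_union_Ici (a := (0:ℝ))]; exact measure_union_le _ _
    rw [ENNReal.toReal_eq_zero_iff] at this
    rcases this with h | h
    · rw [h, hΛsupp n hn, measure_univ] at h1; simp at h1
    · exact measure_ne_top _ _ h
  have hfin : ∀ n : ℕ, 1 ≤ n → ν (Ici (η n)) ≠ ⊤ := by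
    intro n hn h
    apply hpos n hn
    simp [tailNu, h]
  have hgam : Tendsto (fun n => gam b c ν η n) atTop (𝓝 (1/c)) := by
    set C := ∫ s in Ioi (0:ℝ), tailNu ν s * min s 1 with hC
    have h1 : Tendsto (fun n : ℕ => (1 / (n : ℝ)) * ∫ y in Set.Ioi (0 : ℝ), tailNu ν (η n + y))
        atTop (𝓝 0) := by
      have hu : Tendsto (fun n : ℕ => (n:ℝ) * θ n / c + C / (n:ℝ)) atTop (𝓝 0) := by
        have := (hB.div_const c).add (tendsto_const_div_atTop_nhds_zero_nat C)
        simpa using this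
      refine tendsto_of_tendsto_of_tendsto_of_le_of_le' tendsto_const_nhds hu
        (Eventually.of_forall fun n => mul_nonneg (by positivity)
          (integral_nonneg fun _ => tailNu_nonneg _ _))
        ((eventually_ge_atTop 1).mono fun n hn => ?_)
      have hn' : (0:ℝ) < n := by exact_mod_cast hn
      have h := D_le ν hν0 hνint (hη n) (hfin n hn)
      rw [hA n hn, ← hC] at h
      calc _ ≤ (1 / (n:ℝ)) * ((n : ℝ) ^ 2 * θ n / c + C) :=
            mul_le_mul_of_nonneg_left h (by positivity)
        _ = _ := by field_simp
    have h2 := (((tendsto_const_div_atTop_nhds_zero_nat b).const_sub 1).sub h1)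
    have h3 := ((tendsto_const_nhds (x := (0:ℝ)) (f := atTop (α := ℕ))).max h2).const_mul (1/c)
    simpa [gam] using h3
  have hL : ∀ n : ℕ, 1 ≤ n → ∀ t : ℝ, 0 < t →
      θ n * (Λ n (Ici (t/2))).toReal ≤ c * ((1/(n:ℝ)^2) * tailNu ν (t / (2 * n))) := by
    intro n hn t ht
    have hn' : (0:ℝ) < n := by exact_mod_cast hn
    have hp := hpos n hn
    have e : t / 2 / (n:ℝ) = t / (2 * n) := by field_simp
    rw [hΛtail n hn (t/2) (by positivity), e]
    have hm := tailNu_mono (tail_fin ν hνint (show 0 < t / (2 * (n:ℝ)) by positivity))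
      (show t / (2 * (n:ℝ)) ≤ η n + t / (2 * n) by linarith [hη n])
    have e2 : θ n = c * tailNu ν (η n) / (n:ℝ)^2 := by rw [hA n hn]; field_simp
    calc _ = c * ((1/(n:ℝ)^2) * tailNu ν (η n + t / (2 * n))) := by
          rw [e2]; field_simp
      _ ≤ _ := by gcongr
  obtain ⟨β₁, hβ₁⟩ := eventually_atTop.1
    ((F_lim ν hν0 hνint).eventually (ge_mem_nhds (show (0:ℝ) < c / 64 by positivity)))
  refine ⟨max β₁ 1, by positivity, fun β hβ => ?_⟩
  have hβ1 : 1 ≤ β := (le_max_right _ _).trans hβ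
  have hJ := hβ₁ β ((le_max_left _ _).trans hβ)
  have hFi := F_int ν hν0 hνint hβ1
  have hr1 : 0 < 1 / (2 * c) := by positivity
  have hr2 : 0 < 1 / c := by positivity
  have hT1 := (te_tail hr1).eventually (ge_mem_nhds (show (0:ℝ) < c ^ 2 / 16 by positivity))
  have hT2 := (te_lim hr2).eventually (le_mem_nhds
    (show 7 / 8 * c ^ 2 < 1 / (1 / c) ^ 2 by field_simp; norm_num))
  obtain ⟨T, hT1, hT2, hT0⟩ := (hT1.and (hT2.and (eventually_gt_atTop 0))).exists
  have hlim : Tendsto (fun n : ℕ => (1 - θ n) * gam b c ν η n * rexp (-(β * T / (n:ℝ)))) atTop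
      (𝓝 (1/c)) := by
    have h1 := (tendsto_const_div_atTop_nhds_zero_nat (β * T)).neg
    have h2 := (continuous_exp.tendsto _).comp h1
    have h3 := ((hB'.const_sub 1).mul hgam).mul h2
    simpa [Function.comp_def] using h3
  have hlow := hlim.eventually (le_mem_nhds
    (show 6 / 7 * (1 / c) < 1 / c by linarith))
  obtain ⟨n₁, hn₁⟩ := eventually_atTop.1 hlow
  refine ⟨max n₁ 1, le_max_right _ _, T, hT0, fun n hn => ?_, fun n hn => ?_⟩
  · have hn1 : 1 ≤ n := (le_max_right _ _).trans hn
    have hn' : (0:ℝ) < n := by exact_mod_cast hn1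
    have := hΛprob n hn1
    obtain ⟨hSi, hSe⟩ := J_scale ν hn1 hFi
    have hsub : Ioi T ⊆ Ioi (0:ℝ) := Ioi_subset_Ioi hT0.le
    have hi1 := ((te_intOn hr1).mono_set hsub).const_mul (1/c)
    have hi2 := hSi.mono_set hsub
    calc _ ≤ ∫ t in Ioi T, ((1/c) * (t * rexp (-(1/(2*c)) * t)) +
            t * rexp (-(β / (n:ℝ)) * t) * ((1/(n:ℝ)^2) * tailNu ν (t / (2 * n)))) := by
          refine integral_mono_of_nonneg ?_ (hi1.add hi2) ?_
          · refine (ae_restrict_iff' measurableSet_Ioi).2 (ae_of_all _ fun t (ht : T < t) => ?_)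
            have ht0 : 0 < t := hT0.trans ht
            exact mul_nonneg (by positivity) (mul_nonneg (gam_nonneg hc _ _ _)
              (piTail_nonneg hc (hθ n).1 (hθ n).2 _ _))
          · refine (ae_restrict_iff' measurableSet_Ioi).2 (ae_of_all _ fun t (ht : T < t) => ?_)
            have ht0 : 0 < t := hT0.trans ht
            have hp := (piTail_le hc (hθ n).1 (hθ n).2 (Λ n) ht0.le).trans
              (add_le_add_right (hL n hn1 t ht0) _)
            have hg : gam b c ν η n * piTail c (θ n) (Λ n) t ≤ (1/c) *
                (rexp (-(1/(2*c)) * t) + c * ((1/(n:ℝ)^2) * tailNu ν (t / (2 * n)))) :=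
              mul_le_mul (gam_le hb hc _ _ _) hp (piTail_nonneg hc (hθ n).1 (hθ n).2 _ _)
                (by positivity)
            have hE : rexp (-(β / (n:ℝ)) * t) ≤ 1 := by
              apply exp_le_one_iff.2
              have : 0 ≤ β / (n:ℝ) * t := by positivity
              linarith
            have hq : t * rexp (-(β / (n:ℝ)) * t) * ((1/c) * rexp (-(1/(2*c)) * t)) ≤
                t * 1 * ((1/c) * rexp (-(1/(2*c)) * t)) := by gcongr
            calc _ ≤ t * rexp (-(β / (n:ℝ)) * t) * ((1/c) *
                (rexp (-(1/(2*c)) * t) + c * ((1/(n:ℝ)^2) * tailNu ν (t / (2 * n))))) :=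
                  mul_le_mul_of_nonneg_left hg (by positivity)
              _ = t * rexp (-(β / (n:ℝ)) * t) * ((1/c) * rexp (-(1/(2*c)) * t)) +
                  t * rexp (-(β / (n:ℝ)) * t) * ((1/(n:ℝ)^2) * tailNu ν (t / (2 * n))) := by
                  field_simp
              _ ≤ _ := by
                  have : t * 1 * ((1/c) * rexp (-(1/(2*c)) * t)) =
                    (1/c) * (t * rexp (-(1/(2*c)) * t)) := by ring
                  linarith
      _ = (1/c) * (∫ t in Ioi T, t * rexp (-(1/(2*c)) * t)) + ∫ t in Ioi T,
            t * rexp (-(β / (n:ℝ)) * t) * ((1/(n:ℝ)^2) * tailNu ν (t / (2 * n))) := by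
          rw [integral_add hi1 hi2, integral_const_mul]
      _ ≤ (1/c) * (c^2/16) + 4 * (c / 64) := by
          refine add_le_add (mul_le_mul_of_nonneg_left hT1 hr2.le) ?_
          have := setIntegral_mono_set hSi ((ae_restrict_iff' measurableSet_Ioi).2
            (ae_of_all _ fun t (ht : 0 < t) => mul_nonneg (by positivity)
              (mul_nonneg (by positivity) (tailNu_nonneg _ _)))) hsub.eventuallyLE
          rw [hSe] at this
          linarith
      _ = c / 8 := by field_simp; norm_num
  · have hn1 : 1 ≤ n := (le_max_right _ _).trans hn
    have hn' : (0:ℝ) < n := by exact_mod_cast hn1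
    have hl := hn₁ n ((le_max_left _ _).trans hn)
    have := hΛprob n hn1
    have hθ1 : 0 ≤ 1 - θ n := by linarith [(hθ n).2]
    have hg0 := gam_nonneg (b := b) hc ν η n
    set K := (1 - θ n) * gam b c ν η n * rexp (-(β * T / (n:ℝ))) with hK
    have hint : IntervalIntegrable (fun t => t * Real.exp (-(β / (n : ℝ)) * t) *
        (gam b c ν η n * piTail c (θ n) (Λ n) t)) volume 0 T := by
      have ha : AntitoneOn (piTail c (θ n) (Λ n)) (uIcc 0 T) := by
        rw [uIcc_of_le hT0.le]
        exact (piTail_anti hc (hθ n).1 (hθ n).2 (Λ n)).mono Icc_subset_Ici_self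
      refine IntervalIntegrable.continuousOn_mul (ha.intervalIntegrable.const_mul _) ?_
      exact Continuous.continuousOn (by fun_prop)
    have hcont : Continuous fun t : ℝ => K * (t * rexp (-(1/c) * t)) := by fun_prop
    calc 3 * c / 4 = (6 / 7 * (1/c)) * (7 / 8 * c^2) := by field_simp; norm_num
      _ ≤ K * ∫ t in (0:ℝ)..T, t * rexp (-(1/c) * t) :=
          mul_le_mul hl hT2 (by positivity) ((by positivity : 0 ≤ 6 / 7 * (1/c)).trans hl)
      _ = ∫ t in (0:ℝ)..T, K * (t * rexp (-(1/c) * t)) := by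
          rw [intervalIntegral.integral_const_mul]
      _ ≤ _ := by
          refine intervalIntegral.integral_mono_on hT0.le (hcont.intervalIntegrable _ _) hint ?_
          intro t ht
          have hp := piTail_ge hc (hθ n).1 (Λ n) ht.1
          have hE : rexp (-(β * T / (n:ℝ))) ≤ rexp (-(β / (n:ℝ)) * t) := by
            apply exp_le_exp.2
            have : β / (n:ℝ) * t ≤ β / (n:ℝ) * T :=
              mul_le_mul_of_nonneg_left ht.2 (by positivity)
            have e : β * T / (n:ℝ) = β / (n:ℝ) * T := by ring
            rw [e]; linarith
          have e : -(1/c) * t = -t / c := by ring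
          rw [e]
          have ht0 : 0 ≤ t := ht.1
          calc K * (t * rexp (-t/c)) = t * rexp (-(β * T / (n:ℝ))) *
                (gam b c ν η n * ((1 - θ n) * rexp (-t/c))) := by rw [hK]; ring
            _ ≤ _ := by gcongr
end

section
/- There exists a constant β₀ ≥ 0 such that for every β > β₀ there exist n₀ ≥ 1 and C > 0 with |1 − ∫₀^∞ e^{izt − (β/n)t}·γ_n·Π̄_n(t) dt| ≥ C·min(|z|, 1) for all z ∈ ℝ and all n ≥ n₀. -/
open MeasureTheory Real Set Filter Topology

lemma aux_expDens_shift {c : ℝ} (hc : 0 < c) (x u : ℝ) :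
    ∫ y in Ioi x, expDens c (y - u) = Real.exp (-(x - u) / c) := by
  have h : ∀ y : ℝ, expDens c (y - u) = ((1 / c) * Real.exp (u / c)) * Real.exp ((-1 / c) * y) := by
    intro y
    unfold expDens
    rw [mul_assoc, ← Real.exp_add]
    congr 2
    field_simp
    ring
  simp_rw [h]
  rw [integral_const_mul, integral_exp_mul_Ioi (by rw [neg_div]; simpa using hc)]
  have : Real.exp (-(x - u) / c) = Real.exp (u / c) * Real.exp (-1 / c * x) := by
    rw [← Real.exp_add]; congr 1; field_simp; ring
  rw [this]
  field_simp

lemma aux_expDens_int {c : ℝ} (hc : 0 < c) (x : ℝ) :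
    IntegrableOn (expDens c) (Ioi x) := by
  have h : expDens c = fun y => (1 / c) * Real.exp ((-1 / c) * y) := by
    ext y
    unfold expDens
    congr 2
    field_simp
  rw [h]
  exact (integrableOn_exp_mul_Ioi (by rw [neg_div]; simpa using hc) x).const_mul _

lemma aux_inner {c : ℝ} (hc : 0 < c) (x u : ℝ) :
    ∫ y in Ioi x, (Ici (0:ℝ)).indicator (expDens c) (y - u) =
      Real.exp (-(max (x - u) 0) / c) := by
  have h : (fun y => (Ici (0:ℝ)).indicator (expDens c) (y - u)) =
      (Ici u).indicator (fun y => expDens c (y - u)) := by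
    ext y
    simp [indicator_apply]
  rw [h, setIntegral_indicator measurableSet_Ici]
  by_cases hxu : u ≤ x
  · have : Ioi x ∩ Ici u = Ioi x := by
      ext y; simp; intro h; linarith
    rw [this, aux_expDens_shift hc, max_eq_left (by linarith)]
  · push Not at hxu
    have : Ioi x ∩ Ici u = Ici u := by
      ext y; simp; intro h; linarith
    rw [this, integral_Ici_eq_integral_Ioi, aux_expDens_shift hc, max_eq_right (by linarith)]
    simp

lemma aux_piTail {c θ : ℝ} (hc : 0 < c) (Λ : Measure ℝ) [IsProbabilityMeasure Λ]
    (hΛ : Λ (Iic 0) = 0) (x : ℝ) :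
    piTail c θ Λ x = (1 - θ) * Real.exp (-x / c) +
      θ * ∫ u, Real.exp (-(max (x - u) 0) / c) ∂Λ := by
  set k : ℝ → ℝ := (Ici (0:ℝ)).indicator (expDens c) with hk
  have hpos : ∀ᵐ u ∂Λ, 0 < u := by
    rw [ae_iff]; convert hΛ using 2; ext u; simp
  have hkint : Integrable k volume := by
    rw [hk, integrable_indicator_iff measurableSet_Ici, integrableOn_Ici_iff_integrableOn_Ioi]
    exact aux_expDens_int hc 0
  have hconv : ∀ y, ∫ u in Icc (0:ℝ) y, expDens c (y - u) ∂Λ = ∫ u, k (y - u) ∂Λ := by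
    intro y
    rw [← integral_indicator measurableSet_Icc]
    apply integral_congr_ae
    filter_upwards [hpos] with u hu
    simp [hk, indicator_apply, hu.le]
  have hprod : Integrable (Function.uncurry fun y u => k (y - u))
      ((volume.restrict (Ioi x)).prod Λ) := by
    have := Integrable.convolution_integrand (ContinuousLinearMap.mul ℝ ℝ) (μ := volume) (ν := Λ)
      (f := fun _ => (1:ℝ)) (integrable_const _) hkint
    simp only [ContinuousLinearMap.mul_apply', one_mul] at this
    exact this.mono_measure (Measure.prod_mono Measure.restrict_le_self le_rfl)
  have hswap := integral_integral_swap hprod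
  have hint2 : IntegrableOn (fun y => ∫ u, k (y - u) ∂Λ) (Ioi x) := hprod.integral_prod_left
  unfold piTail piDens
  simp_rw [hconv]
  rw [integral_add ((aux_expDens_int hc x).const_mul _) (hint2.const_mul _), integral_const_mul,
    integral_const_mul, hswap]
  have := aux_expDens_shift hc x 0
  simp only [sub_zero] at this
  rw [this]
  congr 2
  apply integral_congr_ae
  filter_upwards with u
  exact aux_inner hc x u

lemma aux_inner2 {c : ℝ} (hc : 0 < c) {s : ℂ} (hs : 0 < s.re) {u : ℝ} (hu : 0 ≤ u) :
    ∫ t in Ioi (0:ℝ), Complex.exp (-s * t) * ((Real.exp (-(max (t - u) 0) / c) : ℝ) : ℂ) =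
      (c + ∫ t in (0:ℝ)..u, Complex.exp (-s * t)) / (1 + c * s) := by
  have hs0 : s ≠ 0 := by rintro rfl; simp at hs
  have hcC : (c : ℂ) ≠ 0 := by exact_mod_cast hc.ne'
  have h1 : (1 + c * s : ℂ) ≠ 0 := by
    intro h
    have := congrArg Complex.re h
    simp at this
    nlinarith [mul_pos hc hs]
  have hre : (-(s + 1 / c) : ℂ).re < 0 := by
    have : (1 / (c:ℂ)).re = 1 / c := by rw [← Complex.ofReal_one, ← Complex.ofReal_div, Complex.ofReal_re]
    rw [Complex.neg_re, Complex.add_re, this]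
    have : 0 < 1 / c := by positivity
    linarith
  have e1 : EqOn (fun t : ℝ => Complex.exp (-s * t) * ((Real.exp (-(max (t - u) 0) / c) : ℝ) : ℂ))
      (fun t : ℝ => Complex.exp (-s * t)) (Ioc 0 u) := by
    intro t ht
    simp [max_eq_right (sub_nonpos.2 ht.2)]
  have e2 : EqOn (fun t : ℝ => Complex.exp (-s * t) * ((Real.exp (-(max (t - u) 0) / c) : ℝ) : ℂ))
      (fun t : ℝ => Complex.exp (u / c) * Complex.exp (-(s + 1 / c) * t)) (Ioi u) := by
    intro t ht
    simp only
    rw [max_eq_left (sub_nonneg.2 (le_of_lt ht)), Complex.ofReal_exp, ← Complex.exp_add,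
      ← Complex.exp_add]
    congr 1
    push_cast
    field_simp
    ring
  rw [← Ioc_union_Ioi_eq_Ioi hu, setIntegral_union (Ioc_disjoint_Ioi le_rfl) measurableSet_Ioi,
    setIntegral_congr_fun measurableSet_Ioc e1, setIntegral_congr_fun measurableSet_Ioi e2,
    integral_const_mul, integral_exp_mul_complex_Ioi hre, ← intervalIntegral.integral_of_le hu,
    integral_exp_mul_complex (neg_ne_zero.2 hs0)]
  · have hE : Complex.exp (-(s + 1 / c) * u) = Complex.exp (-s * u) / Complex.exp (u / c) := by
      rw [← Complex.exp_sub]; congr 1; field_simp; ring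
    have h2 : (s + 1 / c : ℂ) = (1 + c * s) / c := by field_simp; ring
    have h3 := Complex.exp_ne_zero (u / c : ℂ)
    rw [hE, h2]
    simp only [Complex.ofReal_zero, mul_zero, Complex.exp_zero]
    generalize Complex.exp (-s * u) = X
    generalize Complex.exp (u / c : ℂ) = Y at *
    generalize hD : (1 + c * s : ℂ) = D at h1 ⊢
    field_simp
    rw [← hD]
    ring
  · rw [integrableOn_congr_fun e1 measurableSet_Ioc]
    exact (Continuous.integrableOn_Icc (by fun_prop)).mono_set Ioc_subset_Icc_self
  · rw [integrableOn_congr_fun e2 measurableSet_Ioi]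
    exact (integrableOn_exp_mul_complex_Ioi hre u).const_mul _

lemma aux_norm_exp (s : ℂ) (t : ℝ) : ‖Complex.exp (-s * t)‖ = Real.exp (-s.re * t) := by
  rw [Complex.norm_exp]; simp

lemma aux_transform {c θ : ℝ} (hc : 0 < c) (Λ : Measure ℝ) [IsProbabilityMeasure Λ]
    (hΛ : Λ (Iic 0) = 0) {s : ℂ} (hs : 0 < s.re) :
    Integrable (fun u => ∫ t in (0:ℝ)..u, Complex.exp (-s * t)) Λ ∧
    ∫ t in Ioi (0:ℝ), Complex.exp (-s * t) * ((piTail c θ Λ t : ℝ) : ℂ) =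
      (c + θ * ∫ u, (∫ t in (0:ℝ)..u, Complex.exp (-s * t)) ∂Λ) / (1 + c * s) := by
  have hpos : ∀ᵐ u ∂Λ, 0 < u := by
    rw [ae_iff]; convert hΛ using 2; ext u; simp
  have h1 : (1 + c * s : ℂ) ≠ 0 := by
    intro h
    have := congrArg Complex.re h
    simp at this
    nlinarith [mul_pos hc hs]
  have hbase : IntegrableOn (fun t : ℝ => Real.exp (-s.re * t)) (Ioi 0) :=
    integrableOn_exp_mul_Ioi (by linarith) 0
  have hexp1 : ∀ v : ℝ, Real.exp (-(max v 0) / c) ≤ 1 := by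
    intro v
    rw [Real.exp_le_one_iff]
    apply div_nonpos_of_nonpos_of_nonneg _ hc.le
    simp
  have hprod : Integrable (Function.uncurry fun (t u : ℝ) =>
      Complex.exp (-s * t) * ((Real.exp (-(max (t - u) 0) / c) : ℝ) : ℂ))
      ((volume.restrict (Ioi 0)).prod Λ) := by
    refine (hbase.comp_fst Λ).mono' (Continuous.aestronglyMeasurable (by fun_prop)) ?_
    filter_upwards with p
    simp only [Function.uncurry]
    rw [norm_mul, aux_norm_exp, Complex.norm_real, Real.norm_eq_abs, abs_of_pos (Real.exp_pos _)]
    exact mul_le_of_le_one_right (Real.exp_pos _).le (hexp1 _)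
  have hinn : (fun u : ℝ => ∫ t in Ioi (0:ℝ), Complex.exp (-s * t) * ((Real.exp (-(max (t - u) 0) / c) : ℝ) : ℂ))
      =ᵐ[Λ] fun u => (c + ∫ t in (0:ℝ)..u, Complex.exp (-s * t)) / (1 + c * s) := by
    filter_upwards [hpos] with u hu
    exact aux_inner2 hc hs hu.le
  have hI1 : Integrable (fun u => ∫ t in (0:ℝ)..u, Complex.exp (-s * t)) Λ := by
    have h := (hprod.integral_prod_right.congr hinn).mul_const (1 + c * s)
    have h' := h.sub (integrable_const (c:ℂ))
    refine h'.congr ?_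
    filter_upwards with u
    simp only [Pi.sub_apply]
    rw [div_mul_cancel₀ _ h1]; ring
  refine ⟨hI1, ?_⟩
  have hE : ∀ t : ℝ, Complex.exp (-s * t) * ((piTail c θ Λ t : ℝ) : ℂ) =
      (1 - θ) * Complex.exp (-(s + 1 / c) * t) + θ * ∫ u, Complex.exp (-s * t) * ((Real.exp (-(max (t - u) 0) / c) : ℝ) : ℂ) ∂Λ := by
    intro t
    rw [aux_piTail hc Λ hΛ, integral_const_mul]
    have h0 : ∫ u, ((Real.exp (-(max (t - u) 0) / c) : ℝ) : ℂ) ∂Λ =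
        ((∫ u, Real.exp (-(max (t - u) 0) / c) ∂Λ : ℝ) : ℂ) := integral_ofReal
    rw [h0]
    have : Complex.exp (-(s + 1 / c) * t) = Complex.exp (-s * t) * Complex.exp (-t / c) := by
      rw [← Complex.exp_add]; congr 1; ring
    rw [this]
    push_cast
    ring
  have hre : (-(s + 1 / c) : ℂ).re < 0 := by
    have : (1 / (c:ℂ)).re = 1 / c := by rw [← Complex.ofReal_one, ← Complex.ofReal_div, Complex.ofReal_re]
    rw [Complex.neg_re, Complex.add_re, this]
    have : 0 < 1 / c := by positivity
    linarith
  simp_rw [hE]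
  have hL : IntegrableOn (fun t : ℝ => ∫ u, Complex.exp (-s * t) * ((Real.exp (-(max (t - u) 0) / c) : ℝ) : ℂ) ∂Λ) (Ioi 0) :=
    hprod.integral_prod_left
  rw [integral_add ((integrableOn_exp_mul_complex_Ioi hre 0).const_mul _)
    (hL.const_mul _), integral_const_mul, integral_const_mul,
    integral_integral_swap hprod, integral_congr_ae hinn, integral_div, integral_add (integrable_const _) hI1,
    integral_exp_mul_complex_Ioi hre]
  have hcC : (c : ℂ) ≠ 0 := by exact_mod_cast hc.ne'
  have h2 : (s + 1 / c : ℂ) = (1 + c * s) / c := by field_simp; ring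
  rw [h2]
  simp
  field_simp
  ring

noncomputable def auxH (β y : ℝ) : ℝ := ∫ t in (0:ℝ)..y, t * Real.exp (-β * t)

lemma auxH_int (β a b : ℝ) : IntervalIntegrable (fun t => t * Real.exp (-β * t)) volume a b :=
  Continuous.intervalIntegrable (by fun_prop) _ _

lemma aux_imag {z a u : ℝ} (hu : 0 ≤ u) :
    |(∫ t in (0:ℝ)..u, Complex.exp (-((a:ℂ) - z * Complex.I) * t)).im| ≤ |z| * auxH a u := by
  have hi : IntervalIntegrable (fun t : ℝ => Complex.exp (-((a:ℂ) - z * Complex.I) * t)) volume 0 u :=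
    Continuous.intervalIntegrable (by fun_prop) _ _
  have h1 : (∫ t in (0:ℝ)..u, Complex.exp (-((a:ℂ) - z * Complex.I) * t)).im =
      ∫ t in (0:ℝ)..u, (Complex.exp (-((a:ℂ) - z * Complex.I) * t)).im := by
    exact (Complex.imCLM.intervalIntegral_comp_comm hi).symm
  rw [h1, auxH, ← intervalIntegral.integral_const_mul, ← Real.norm_eq_abs]
  apply intervalIntegral.norm_integral_le_of_norm_le hu
  · filter_upwards with t ht
    rw [Complex.exp_im]
    simp
    have : |Real.sin (z * t)| ≤ |z| * t := by
      refine (Real.abs_sin_le_abs).trans ?_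
      rw [abs_mul, abs_of_pos ht.1]
    calc _ ≤ Real.exp (-(a * t)) * (|z| * t) := by gcongr
      _ = _ := by ring
  · exact (auxH_int a 0 u).const_mul _

lemma auxH_scale {n β y : ℝ} (hn : 0 < n) : auxH (β / n) (n * y) = n ^ 2 * auxH β y := by
  unfold auxH
  have := intervalIntegral.mul_integral_comp_mul_left (f := fun t => t * Real.exp (-(β / n) * t)) n (a := 0) (b := y)
  rw [mul_zero] at this
  rw [← this, pow_two, mul_assoc]
  congr 1
  rw [← intervalIntegral.integral_const_mul]
  congr 1
  ext t
  have : -(β / n) * (n * t) = -β * t := by field_simp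
  rw [this]; ring

lemma auxH_nonneg (β : ℝ) {y : ℝ} (hy : 0 ≤ y) : 0 ≤ auxH β y := by
  apply intervalIntegral.integral_nonneg hy
  intro t ht
  exact mul_nonneg ht.1 (Real.exp_pos _).le

lemma auxH_anti {β β' y : ℝ} (h : β ≤ β') (hy : 0 ≤ y) : auxH β' y ≤ auxH β y := by
  apply intervalIntegral.integral_mono_on hy (auxH_int _ _ _) (auxH_int _ _ _)
  intro t ht
  have := ht.1
  gcongr

lemma aux_texp {β t : ℝ} (hβ : 0 < β) : t * Real.exp (-β * t) ≤ 1 / β := by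
  have h1 : β * t ≤ Real.exp (β * t) := by linarith [Real.add_one_le_exp (β * t)]
  rw [neg_mul, Real.exp_neg, le_div_iff₀ hβ]
  have := Real.exp_pos (β * t)
  rw [← div_eq_mul_inv, div_mul_eq_mul_div, div_le_one this]
  linarith

lemma auxH_le1 {β y : ℝ} (hβ : 0 < β) (hy : 0 ≤ y) : auxH β y ≤ y / β := by
  calc auxH β y ≤ ∫ t in (0:ℝ)..y, 1 / β := by
        apply intervalIntegral.integral_mono_on hy (auxH_int _ _ _) (by simp)
        intro t _
        exact aux_texp hβ
    _ = _ := by simp; ring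

lemma auxH_le2 {β y : ℝ} (hβ : 0 ≤ β) (hy : 0 ≤ y) : auxH β y ≤ y ^ 2 := by
  calc auxH β y ≤ ∫ t in (0:ℝ)..y, y := by
        apply intervalIntegral.integral_mono_on hy (auxH_int _ _ _) (by simp)
        intro t ht
        refine (mul_le_of_le_one_right ht.1 ?_).trans ht.2
        rw [Real.exp_le_one_iff]; nlinarith [ht.1]
    _ = _ := by simp; ring

lemma auxH_cont (β : ℝ) : Continuous (auxH β) :=
  intervalIntegral.continuous_primitive (auxH_int β) 0

lemma aux_beta {c : ℝ} (hc : 0 < c) (ν : Measure ℝ)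
    (hνint : ∫⁻ y in Set.Ioi (0 : ℝ), ENNReal.ofReal (min y (y ^ 2)) ∂ν ≠ ⊤) :
    ∃ β₀ : ℝ, 0 ≤ β₀ ∧ ∀ β, β₀ < β →
      ∫⁻ y in Ioi (0:ℝ), ENNReal.ofReal (auxH β y) ∂ν ≤ ENNReal.ofReal (c / 2) := by
  have hlim : Tendsto (fun k : ℕ => ∫⁻ y in Ioi (0:ℝ), ENNReal.ofReal (auxH ((k:ℝ) + 1) y) ∂ν) atTop
      (𝓝 (∫⁻ y in Ioi (0:ℝ), 0 ∂ν)) := by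
    apply tendsto_lintegral_of_dominated_convergence (fun y => ENNReal.ofReal (min y (y ^ 2)))
    · intro k
      exact (auxH_cont _).measurable.ennreal_ofReal
    · intro k
      filter_upwards [ae_restrict_mem measurableSet_Ioi] with y hy
      have hy' : (0:ℝ) ≤ y := le_of_lt hy
      apply ENNReal.ofReal_le_ofReal
      apply le_min
      · refine (auxH_le1 (by positivity) hy').trans ?_
        apply div_le_self hy'
        have : (0:ℝ) ≤ k := by positivity
        linarith
      · exact auxH_le2 (by positivity) hy'
    · exact hνint
    · filter_upwards [ae_restrict_mem measurableSet_Ioi] with y hy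
      have hy' : (0:ℝ) ≤ y := le_of_lt hy
      rw [← ENNReal.ofReal_zero]
      apply ENNReal.tendsto_ofReal
      have h0 : Tendsto (fun k : ℕ => y * (1 / ((k:ℝ) + 1))) atTop (𝓝 0) := by
        simpa using tendsto_one_div_add_atTop_nhds_zero_nat.const_mul y
      refine squeeze_zero (fun k => auxH_nonneg _ hy') (fun k => ?_) h0
      refine (auxH_le1 (by positivity) hy').trans (le_of_eq (by ring))
  rw [lintegral_zero] at hlim
  have hev := hlim.eventually_lt_const (u := ENNReal.ofReal (c / 2)) (by simpa using hc)
  obtain ⟨k, hk⟩ := hev.exists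
  refine ⟨(k:ℝ) + 1, by positivity, fun β hβ => le_trans ?_ hk.le⟩
  apply lintegral_mono_ae
  filter_upwards [ae_restrict_mem measurableSet_Ioi] with y hy
  exact ENNReal.ofReal_le_ofReal (auxH_anti hβ.le (le_of_lt hy))

lemma aux_compare {c θ η β n : ℝ} (hn : 0 < n) (hc : 0 < c) (hη : 0 ≤ η) (hθ : 0 ≤ θ)
    (ν Λ : Measure ℝ) [IsProbabilityMeasure Λ]
    (hν0 : ν (Iic 0) = 0) (hΛ : Λ (Iic 0) = 0)
    (hrel : ∀ t, 0 ≤ t → θ * (Λ (Ici t)).toReal = c / n ^ 2 * tailNu ν (η + t / n)) :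
    ENNReal.ofReal θ * ∫⁻ u, ENNReal.ofReal (auxH (β / n) u) ∂Λ ≤
      ENNReal.ofReal c * ∫⁻ y in Ioi (0:ℝ), ENNReal.ofReal (auxH β y) ∂ν := by
  have hposΛ : ∀ᵐ u ∂Λ, 0 < u := by
    rw [ae_iff]; convert hΛ using 2; ext u; simp
  have hposν : ∀ᵐ u ∂ν, 0 < u := by
    rw [ae_iff]; convert hν0 using 2; ext u; simp
  have hres : ν.restrict (Ioi 0) = ν := Measure.restrict_eq_self_of_ae_mem hposν
  have hgnn : ∀ᵐ t ∂volume.restrict (Ioi (0:ℝ)), 0 ≤ t * Real.exp (-(β / n) * t) := by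
    filter_upwards [ae_restrict_mem measurableSet_Ioi] with t ht
    exact mul_nonneg (le_of_lt ht) (Real.exp_pos _).le
  have L1 := lintegral_comp_eq_lintegral_meas_le_mul Λ (f := fun u => u)
    (g := fun t => t * Real.exp (-(β / n) * t)) (hposΛ.mono fun u hu => hu.le)
    aemeasurable_id (fun t _ => auxH_int _ _ _) hgnn
  have L2 := lintegral_comp_eq_lintegral_meas_le_mul ν (f := fun y => n * y)
    (g := fun t => t * Real.exp (-(β / n) * t)) (hposν.mono fun u hu => (mul_pos hn hu).le)
    (by fun_prop) (fun t _ => auxH_int _ _ _) hgnn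
  have e1 : ∫⁻ u, ENNReal.ofReal (auxH (β / n) u) ∂Λ = _ := L1
  have e2 : ∫⁻ y, ENNReal.ofReal (auxH (β / n) (n * y)) ∂ν = _ := L2
  have e3 : ∫⁻ y, ENNReal.ofReal (auxH (β / n) (n * y)) ∂ν =
      ENNReal.ofReal (n ^ 2) * ∫⁻ y, ENNReal.ofReal (auxH β y) ∂ν := by
    simp_rw [auxH_scale hn, ENNReal.ofReal_mul (sq_nonneg n)]
    rw [lintegral_const_mul _ (auxH_cont _).measurable.ennreal_ofReal]
  have e4 : ENNReal.ofReal c * ∫⁻ y, ENNReal.ofReal (auxH β y) ∂ν =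
      ENNReal.ofReal (c / n ^ 2) * ∫⁻ y, ENNReal.ofReal (auxH (β / n) (n * y)) ∂ν := by
    rw [e3, ← mul_assoc, ← ENNReal.ofReal_mul (by positivity)]
    congr 2
    field_simp
  rw [hres, e4, e1, e2, ← lintegral_const_mul' _ _ ENNReal.ofReal_ne_top,
    ← lintegral_const_mul' _ _ ENNReal.ofReal_ne_top]
  apply lintegral_mono_ae
  filter_upwards [ae_restrict_mem measurableSet_Ioi] with t ht
  have ht' : (0:ℝ) ≤ t := le_of_lt ht
  rw [← mul_assoc, ← mul_assoc]
  gcongr ?_ * _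
  have hset : {a : ℝ | t ≤ n * a} = Ici (t / n) := by
    ext a; simp [div_le_iff₀' hn]
  have hset' : {a : ℝ | t ≤ a} = Ici t := rfl
  rw [hset, hset', ← ENNReal.ofReal_toReal (measure_ne_top Λ (Ici t)), ← ENNReal.ofReal_mul hθ,
    hrel t ht', ENNReal.ofReal_mul (by positivity)]
  gcongr
  exact ENNReal.ofReal_toReal_le.trans (measure_mono (Ici_subset_Ici.2 (by linarith)))

lemma aux_im_bound {c θ η β n z : ℝ} (hn : 0 < n) (hc : 0 < c) (hη : 0 ≤ η) (hθ : 0 ≤ θ)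
    (ν Λ : Measure ℝ) [IsProbabilityMeasure Λ]
    (hν0 : ν (Iic 0) = 0) (hΛ : Λ (Iic 0) = 0)
    (hrel : ∀ t, 0 ≤ t → θ * (Λ (Ici t)).toReal = c / n ^ 2 * tailNu ν (η + t / n))
    (hβ : ∫⁻ y in Ioi (0:ℝ), ENNReal.ofReal (auxH β y) ∂ν ≤ ENNReal.ofReal (c / 2))
    (hI : Integrable (fun u => ∫ t in (0:ℝ)..u,
      Complex.exp (-(((β / n : ℝ):ℂ) - z * Complex.I) * t)) Λ) :
    θ * |(∫ u, (∫ t in (0:ℝ)..u,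
      Complex.exp (-(((β / n : ℝ):ℂ) - z * Complex.I) * t)) ∂Λ).im| ≤ |z| * (c * (c / 2)) := by
  have hposΛ : ∀ᵐ u ∂Λ, 0 < u := by
    rw [ae_iff]; convert hΛ using 2; ext u; simp
  have hcmp := aux_compare (β := β) hn hc hη hθ ν Λ hν0 hΛ hrel
  have him : (∫ u, (∫ t in (0:ℝ)..u,
      Complex.exp (-(((β / n : ℝ):ℂ) - z * Complex.I) * t)) ∂Λ).im = ∫ u, (∫ t in (0:ℝ)..u,
      Complex.exp (-(((β / n : ℝ):ℂ) - z * Complex.I) * t)).im ∂Λ :=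
    (integral_im hI).symm
  rw [him]
  have h1 : ENNReal.ofReal |∫ u, (∫ t in (0:ℝ)..u,
      Complex.exp (-(((β / n : ℝ):ℂ) - z * Complex.I) * t)).im ∂Λ| ≤
      ENNReal.ofReal |z| * ∫⁻ u, ENNReal.ofReal (auxH (β / n) u) ∂Λ := by
    rw [← Real.norm_eq_abs, ofReal_norm]
    refine (enorm_integral_le_lintegral_enorm _).trans ?_
    rw [← lintegral_const_mul' _ _ ENNReal.ofReal_ne_top]
    apply lintegral_mono_ae
    filter_upwards [hposΛ] with u hu
    rw [← ENNReal.ofReal_mul (abs_nonneg z), ← ofReal_norm, Real.norm_eq_abs]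
    exact ENNReal.ofReal_le_ofReal (aux_imag hu.le)
  rw [← ENNReal.ofReal_le_ofReal_iff (by positivity), ENNReal.ofReal_mul hθ,
    ENNReal.ofReal_mul (abs_nonneg z), ENNReal.ofReal_mul hc.le]
  calc _ ≤ ENNReal.ofReal θ * (ENNReal.ofReal |z| * ∫⁻ u, ENNReal.ofReal (auxH (β / n) u) ∂Λ) := by gcongr
    _ = ENNReal.ofReal |z| * (ENNReal.ofReal θ * ∫⁻ u, ENNReal.ofReal (auxH (β / n) u) ∂Λ) := by ring
    _ ≤ ENNReal.ofReal |z| * (ENNReal.ofReal c * ∫⁻ y in Ioi (0:ℝ), ENNReal.ofReal (auxH β y) ∂ν) := by gcongr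
    _ ≤ _ := by gcongr

lemma aux_gam (b c : ℝ) (hb : 0 ≤ b) (hc : 0 < c) (ν : Measure ℝ) (η : ℕ → ℝ) (n : ℕ) :
    0 ≤ gam b c ν η n ∧ gam b c ν η n ≤ 1 / c := by
  unfold gam
  have h1 : 0 ≤ ∫ y in Set.Ioi (0 : ℝ), tailNu ν (η n + y) :=
    integral_nonneg fun y => ENNReal.toReal_nonneg
  have h2 : 0 ≤ b / (n:ℝ) := by positivity
  have h3 : 0 ≤ (1 / (n : ℝ)) * ∫ y in Set.Ioi (0 : ℝ), tailNu ν (η n + y) := by positivity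
  refine ⟨by positivity, mul_le_of_le_one_right (by positivity) (max_le zero_le_one (by linarith))⟩


/-- Proposition 4.8: uniform lower bound `|1 − ∫₀^∞ e^{izt−(β/n)t} γ_n Π̄_n(t) dt| ≥ C(|z|∧1)`. -/
theorem stmt12
    (b c : ℝ) (hb : 0 ≤ b) (hc : 0 < c)
    (ν : Measure ℝ) (hν0 : ν (Set.Iic 0) = 0)
    (hνint : ∫⁻ y in Set.Ioi (0 : ℝ), ENNReal.ofReal (min y (y ^ 2)) ∂ν ≠ ⊤)
    (η θ : ℕ → ℝ) (hη : ∀ n : ℕ, 0 ≤ η n) (hθ : ∀ n : ℕ, 0 ≤ θ n ∧ θ n < 1)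
    (hseq : (ν (Set.Ici (0 : ℝ)) ≠ ⊤ ∧ (∀ n : ℕ, 1 ≤ n → η n = 0) ∧
        (∀ n : ℕ, 1 ≤ n → θ n = c * tailNu ν 0 / (n : ℝ) ^ 2)) ∨
      (ν (Set.Ici (0 : ℝ)) = ⊤ ∧
        Filter.Tendsto (fun n : ℕ => (n : ℝ) * θ n) Filter.atTop (nhds 0) ∧
        Filter.Tendsto (fun n : ℕ => (n : ℝ) ^ 2 * θ n) Filter.atTop Filter.atTop ∧
        (∀ n : ℕ, 1 ≤ n → tailNu ν (η n) = (n : ℝ) ^ 2 * θ n / c)))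
    (Λ : ℕ → Measure ℝ)
    (hΛprob : ∀ n : ℕ, 1 ≤ n → IsProbabilityMeasure (Λ n))
    (hΛsupp : ∀ n : ℕ, 1 ≤ n → Λ n (Set.Iic 0) = 0)
    (hΛtail : ∀ n : ℕ, 1 ≤ n → ∀ y : ℝ, 0 ≤ y →
      ((Λ n) (Set.Ici y)).toReal = tailNu ν (η n + y / (n : ℝ)) / tailNu ν (η n))
    :
    ∃ β₀ : ℝ, 0 ≤ β₀ ∧ ∀ β : ℝ, β₀ < β → ∃ n₀ : ℕ, 1 ≤ n₀ ∧ ∃ C : ℝ, 0 < C ∧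
      ∀ z : ℝ, ∀ n : ℕ, n₀ ≤ n →
        C * min |z| 1 ≤
          ‖(1 : ℂ) - ∫ t in Set.Ioi (0 : ℝ),
            Complex.exp (((z : ℂ) * Complex.I - ((β / (n : ℝ) : ℝ) : ℂ)) * (t : ℂ)) *
              ((gam b c ν η n * piTail c (θ n) (Λ n) t : ℝ) : ℂ)‖ := by
  obtain ⟨β₀, hβ₀, hB⟩ := aux_beta hc ν hνint
  refine ⟨β₀, hβ₀, fun β hβ => ⟨1, le_rfl, c / (2 * (1 + c * β + c)), ?_, ?_⟩⟩
  · have : 0 < β := lt_of_le_of_lt hβ₀ hβ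
    positivity
  intro z n hn
  have hβpos : 0 < β := lt_of_le_of_lt hβ₀ hβ
  have hn1 : (1:ℝ) ≤ n := by exact_mod_cast hn
  have hn0 : (0:ℝ) < n := by linarith
  have := hΛprob n hn
  have hΛ0 := hΛsupp n hn
  have htail0 : tailNu ν (η n) ≠ 0 := by
    intro h
    have h1 := hΛtail n hn 0 le_rfl
    rw [h, div_zero, ENNReal.toReal_eq_zero_iff] at h1
    rcases h1 with h1 | h1
    · have h2 : (Λ n) univ ≤ 0 := by
        calc (Λ n) univ = (Λ n) (Iic 0 ∪ Ici 0) := by rw [Iic_union_Ici]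
          _ ≤ Λ n (Iic 0) + Λ n (Ici 0) := measure_union_le _ _
          _ = 0 := by rw [hΛ0, h1, add_zero]
      rw [measure_univ] at h2
      simp at h2
    · exact measure_ne_top _ _ h1
  have hθν : θ n = c / (n:ℝ) ^ 2 * tailNu ν (η n) := by
    rcases hseq with ⟨_, h1, h2⟩ | ⟨_, _, _, h2⟩
    · rw [h2 n hn, h1 n hn]; ring
    · rw [h2 n hn]; field_simp
  have hrel : ∀ t, 0 ≤ t → θ n * ((Λ n) (Ici t)).toReal =
      c / (n:ℝ) ^ 2 * tailNu ν (η n + t / n) := by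
    intro t ht
    rw [hΛtail n hn t ht, hθν]
    field_simp
  set s : ℂ := ((β / (n:ℝ) : ℝ) : ℂ) - z * Complex.I with hs
  have hsre : s.re = β / n := by simp [hs]
  have hsim : s.im = -z := by simp [hs]
  have hspos : 0 < s.re := by rw [hsre]; positivity
  obtain ⟨hI, hT⟩ := aux_transform (θ := θ n) hc (Λ n) hΛ0 hspos
  have hbd := aux_im_bound (z := z) hn0 hc (hη n) (hθ n).1 ν (Λ n) hν0 hΛ0 hrel (hB β hβ) hI
  rw [← hs] at hbd
  obtain ⟨hg0, hg1⟩ := aux_gam b c hb hc ν η n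
  set g := gam b c ν η n with hg
  set E : ℂ := ∫ u, (∫ t in (0:ℝ)..u, Complex.exp (-s * t)) ∂(Λ n) with hE
  have hint : ∫ t in Set.Ioi (0 : ℝ),
            Complex.exp (((z : ℂ) * Complex.I - ((β / (n : ℝ) : ℝ) : ℂ)) * (t : ℂ)) *
              ((g * piTail c (θ n) (Λ n) t : ℝ) : ℂ) = g * ((c + θ n * E) / (1 + c * s)) := by
    rw [← hT, ← integral_const_mul]
    congr 1
    ext t
    have : (z : ℂ) * Complex.I - ((β / (n : ℝ) : ℝ) : ℂ) = -s := by rw [hs]; ring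
    rw [this]
    push_cast
    ring
  rw [hint]
  have h1 : (1 + c * s : ℂ) ≠ 0 := by
    intro h
    have := congrArg Complex.re h
    simp at this
    nlinarith [mul_pos hc hspos]
  have h2 : (1:ℂ) - g * ((c + θ n * E) / (1 + c * s)) =
      (1 + c * s - g * (c + θ n * E)) / (1 + c * s) := by
    field_simp
  have hden : ‖(1 + c * s : ℂ)‖ ≤ 1 + c * β + c * |z| := by
    refine (norm_add_le _ _).trans ?_
    rw [norm_one, norm_mul, Complex.norm_real, Real.norm_eq_abs, abs_of_pos hc]
    have h3 := Complex.norm_le_abs_re_add_abs_im s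
    rw [hsre, hsim, abs_neg, abs_of_pos (by positivity)] at h3
    have h4 : β / n ≤ β := div_le_self hβpos.le hn1
    nlinarith
  have hnum : c / 2 * |z| ≤ ‖(1 + c * s - g * (c + θ n * E) : ℂ)‖ := by
    refine le_trans ?_ (Complex.abs_im_le_norm _)
    have h3 : (1 + c * s - g * (c + θ n * E) : ℂ).im = -(c * z + g * (θ n * E.im)) := by
      simp [hsim]; ring
    rw [h3, abs_neg]
    have h4 : |g * (θ n * E.im)| ≤ c / 2 * |z| := by
      rw [abs_mul, abs_mul, abs_of_nonneg hg0, abs_of_nonneg (hθ n).1]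
      calc g * (θ n * |E.im|) ≤ 1 / c * (|z| * (c * (c / 2))) := by
            have := (hθ n).1
            gcongr
        _ = c / 2 * |z| := by field_simp
    have h5 : |c * z| = c * |z| := by rw [abs_mul, abs_of_pos hc]
    have h6 := abs_sub_abs_le_abs_sub (c * z) (-(g * (θ n * E.im)))
    rw [abs_neg, sub_neg_eq_add] at h6
    linarith
  have hdpos : 0 < ‖(1 + c * s : ℂ)‖ := norm_pos_iff.2 h1
  rw [h2, norm_div, le_div_iff₀ hdpos]
  refine le_trans ?_ hnum
  have hz := abs_nonneg z
  have hA : 0 < 1 + c * β + c := by positivity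
  calc c / (2 * (1 + c * β + c)) * min |z| 1 * ‖(1 + c * s : ℂ)‖
      ≤ c / (2 * (1 + c * β + c)) * min |z| 1 * (1 + c * β + c * |z|) := by
        have : 0 ≤ min |z| 1 := le_min hz zero_le_one
        gcongr
    _ = c / (2 * (1 + c * β + c)) * (min |z| 1 * (1 + c * β + c * |z|)) := by ring
    _ ≤ c / (2 * (1 + c * β + c)) * (|z| * (1 + c * β + c)) := by
        gcongr ?_ * ?_
        have hcb : 0 < c * β := by positivity
        rcases le_total |z| 1 with h | h
        · rw [min_eq_left h]; gcongr; nlinarith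
        · rw [min_eq_right h]; nlinarith
    _ = c / 2 * |z| := by field_simp
end
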